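/- Let M be a perfect matching in a many-to-many instance G. Then M is a popular perfect matching in G if and only if there exists a one-to-one realization M' of M such that M' is a popular perfect matching in the one-to-one instance G'_{M'}. -/

import Mathlib

/-- Vote of a vertex comparing a neighbor of rank `x` with a neighbor of rank `y`
(lower rank = more preferred). -/
def vsgn (x y : ℕ) : ℤ := if x < y then 1 else if y < x then -1 else 0

/-- Vote in the cloned instance: clone preferences are lexicographic, first by the
rank of the underlying vertex, then by the clone index (lower index preferred). -/
def lsgn (r j r' j' : ℕ) : ℤ :=
  if r < r' ∨ (r = r' ∧ j < j') then 1
  else if r' < r ∨ (r' = r ∧ j' < j) then -1 else 0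

/-- The clones of the vertices of `A`: vertex `a` is replaced by `cap a` clones. -/
abbrev Clones {A : Type*} (cap : A → ℕ) : Type _ := (a : A) × Fin (cap a)

/-- `M(a)`, the set of jobs matched to agent `a`. -/
def jobsOf {A B : Type*} [DecidableEq A] [DecidableEq B]
    (M : Finset (A × B)) (a : A) : Finset B :=
  (M.filter (fun e => e.1 = a)).image Prod.snd

/-- `M(b)`, the set of agents matched to job `b`. -/
def agentsOf {A B : Type*} [DecidableEq A] [DecidableEq B]
    (M : Finset (A × B)) (b : B) : Finset A :=
  (M.filter (fun e => e.2 = b)).image Prod.fst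

/-- The set of possible values `∑_{u ∈ S} vote(u, σ u)` over bijections `σ : S ≃ T`;
the vote `vote_v(S,T)` of the paper is the least element of this set. -/
def voteSet {B : Type*} (r : B → ℕ) (S T : Finset B) : Set ℤ :=
  {z | ∃ σ : {x // x ∈ S} ≃ {x // x ∈ T},
    z = ∑ x : {x // x ∈ S}, vsgn (r x.1) (r ((σ x).1))}

/-- A perfect matching in the many-to-many instance: `M ⊆ E` and every vertex `v`
is matched to exactly `cap v` partners. -/
def IsPerfect {A B : Type*} [DecidableEq A] [DecidableEq B]
    (E M : Finset (A × B)) (capA : A → ℕ) (capB : B → ℕ) : Prop :=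
  M ⊆ E ∧ (∀ a, (M.filter (fun e => e.1 = a)).card = capA a) ∧
    ∀ b, (M.filter (fun e => e.2 = b)).card = capB b

/-- `M` is a popular perfect matching: `M` is perfect and `Δ(M,N) ≥ 0` for every
perfect matching `N`, where each vertex votes using the most adversarial bijection
between `M(v) \ N(v)` and `N(v) \ M(v)`.  Since the minima at distinct vertices are
independent, `Δ(M,N) ≥ 0` is equivalent to: every choice of one vote value per
vertex sums to a nonnegative number. -/
def PopularPerfect {A B : Type*} [Fintype A] [Fintype B] [DecidableEq A] [DecidableEq B]
    (E : Finset (A × B)) (capA : A → ℕ) (capB : B → ℕ)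
    (rA : A → B → ℕ) (rB : B → A → ℕ) (M : Finset (A × B)) : Prop :=
  IsPerfect E M capA capB ∧
    ∀ N : Finset (A × B), IsPerfect E N capA capB →
      ∀ za : A → ℤ, ∀ zb : B → ℤ,
        (∀ a, za a ∈ voteSet (rA a) (jobsOf M a \ jobsOf N a) (jobsOf N a \ jobsOf M a)) →
        (∀ b, zb b ∈ voteSet (rB b) (agentsOf M b \ agentsOf N b) (agentsOf N b \ agentsOf M b)) →
        0 ≤ (∑ a, za a) + ∑ b, zb b

/-- `M'` is a one-to-one realization of the many-to-many matching `M` in the cloned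
instance: every `M'`-edge projects to an `M`-edge, and distinct clones of the same
agent are matched to clones of distinct jobs (so each `M`-edge is used once). -/
def Realizes {A B : Type*} {capA : A → ℕ} {capB : B → ℕ}
    (M' : Clones capA ≃ Clones capB) (M : Finset (A × B)) : Prop :=
  (∀ x, (x.1, (M' x).1) ∈ M) ∧
    ∀ x y : Clones capA, x ≠ y → x.1 = y.1 → (M' x).1 ≠ (M' y).1

/-- The edge set `E'_{M'}` of the instance `G'_{M'}`: the edges of `M'` together
with all clone-copies of edges of `E \ M`. -/
def inEM {A B : Type*} [DecidableEq A] [DecidableEq B] {capA : A → ℕ} {capB : B → ℕ}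
    (E M : Finset (A × B)) (M' : Clones capA ≃ Clones capB)
    (x : Clones capA) (y : Clones capB) : Prop :=
  M' x = y ∨ ((x.1, y.1) ∈ E ∧ (x.1, y.1) ∉ M)

/-- `wt_{M'}(x,y) = vote_x(y, M'(x)) + vote_y(x, M'(y))` in the cloned instance. -/
def wtEdge {A B : Type*} {capA : A → ℕ} {capB : B → ℕ}
    (rA : A → B → ℕ) (rB : B → A → ℕ) (M' : Clones capA ≃ Clones capB)
    (x : Clones capA) (y : Clones capB) : ℤ :=
  lsgn (rA x.1 y.1) y.2 (rA x.1 (M' x).1) (M' x).2 +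
    lsgn (rB y.1 x.1) x.2 (rB y.1 (M'.symm y).1) (M'.symm y).2

/-- An alternating cycle with respect to the (perfect one-to-one) matching `M'`,
with non-matching edges taken from the edge relation `Edge`: the cycle visits the
distinct clones `f 0, g 0, f 1, g 1, …` cyclically, `(f t, g t)` being `M'`-edges
and `(f (t+1), g t)` being non-matching edges of the instance. -/
structure AltCycle {A B : Type*} {capA : A → ℕ} {capB : B → ℕ}
    (M' : Clones capA ≃ Clones capB)
    (Edge : Clones capA → Clones capB → Prop) where
  m : ℕ
  f : Fin (m + 2) → Clones capA
  g : Fin (m + 2) → Clones capB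
  hf : Function.Injective f
  hg : Function.Injective g
  hmatch : ∀ t, M' (f t) = g t
  hnonmatch : ∀ t, M' (f (t + 1)) ≠ g t
  hedge : ∀ t, Edge (f (t + 1)) (g t)

/-- The weight `wt_{M'}(C)` of an alternating cycle: the sum of the weights of all
its edges. -/
def AltCycle.wt {A B : Type*} {capA : A → ℕ} {capB : B → ℕ}
    {M' : Clones capA ≃ Clones capB} {Edge : Clones capA → Clones capB → Prop}
    (C : AltCycle M' Edge) (rA : A → B → ℕ) (rB : B → A → ℕ) : ℤ :=
  ∑ t : Fin (C.m + 2),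
    (wtEdge rA rB M' (C.f t) (C.g t) + wtEdge rA rB M' (C.f (t + 1)) (C.g t))

/-- A cycle is valid if no two of its non-matching edges are clone-copies of the
same edge of `G` (matching edges are automatically distinct copies). -/
def AltCycle.Valid {A B : Type*} {capA : A → ℕ} {capB : B → ℕ}
    {M' : Clones capA ≃ Clones capB} {Edge : Clones capA → Clones capB → Prop}
    (C : AltCycle M' Edge) : Prop :=
  Function.Injective (fun t : Fin (C.m + 2) => ((C.f (t + 1)).1, (C.g t).1))

/-- The one-to-one vote difference `Δ(M',N')` in the cloned instance: each clone
compares its `M'`-partner with its `N'`-partner (lexicographic clone preferences). -/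
def Delta' {A B : Type*} [Fintype A] [Fintype B] {capA : A → ℕ} {capB : B → ℕ}
    (rA : A → B → ℕ) (rB : B → A → ℕ)
    (M' N' : Clones capA ≃ Clones capB) : ℤ :=
  (∑ x : Clones capA,
      lsgn (rA x.1 (M' x).1) (M' x).2 (rA x.1 (N' x).1) (N' x).2) +
    ∑ y : Clones capB,
      lsgn (rB y.1 (M'.symm y).1) (M'.symm y).2 (rB y.1 (N'.symm y).1) (N'.symm y).2

section PermCycles

open Equiv

variable {X κ : Type*} [Fintype X]

/-- If the total weight of a permutation is negative, so is the weight of one of its cycles. -/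
theorem exists_isCycle_sum_neg (w : X → X → ℤ) (hw : ∀ x, w x x = 0) (π : Perm X)
    (hneg : ∑ x, w x (π x) < 0) :
    ∃ c : Perm X, c.IsCycle ∧ (∀ x, c x = x ∨ c x = π x) ∧ ∑ x, w x (c x) < 0 := by
  classical
  induction π using Perm.cycle_induction_on with
  | base_one => simp [hw] at hneg
  | base_cycles σ hσ => exact ⟨σ, hσ, fun x => Or.inr rfl, hneg⟩
  | induction_disjoint σ τ hd _ ihσ ihτ =>
    have hστ : ∀ x, τ x = x → (σ * τ) x = σ x := fun x h => by simp [h]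
    have hτσ : ∀ x, σ x = x → (σ * τ) x = τ x := fun x h => by
      rw [hd.commute.eq]; simp [h]
    have hsum : ∑ x, w x ((σ * τ) x) = ∑ x, w x (σ x) + ∑ x, w x (τ x) := by
      rw [← Finset.sum_add_distrib]
      refine Finset.sum_congr rfl fun x _ => ?_
      rcases hd x with h | h
      · rw [hτσ x h, h, hw, zero_add]
      · rw [hστ x h, h, hw, add_zero]
    rw [hsum] at hneg
    rcases lt_or_ge (∑ x, w x (σ x)) 0 with h | h
    · obtain ⟨c, hc, hcσ, hcn⟩ := ihσ h
      refine ⟨c, hc, fun x => ?_, hcn⟩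
      rcases hd x with hx | hx
      · left; rcases hcσ x with h' | h' <;> simp [h', hx]
      · rw [hστ x hx]; exact hcσ x
    · obtain ⟨c, hc, hcτ, hcn⟩ := ihτ (by linarith)
      refine ⟨c, hc, fun x => ?_, hcn⟩
      rcases hd x with hx | hx
      · rw [hτσ x hx]; exact hcτ x
      · left; rcases hcτ x with h' | h' <;> simp [h', hx]

/-- A negative-weight permutation along a relation `R` can be chosen so that its moves have
distinct keys, provided exchanging the targets of two moves with the same key preserves
both `R` and the total weight. -/
theorem exists_perm_injOn_key (w : X → X → ℤ) (hw : ∀ x, w x x = 0)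
    (R : X → X → Prop) (K : X → X → κ)
    (hR : ∀ x y u v, R x u → R y v → K x u = K y v → R x v)
    (hex : ∀ x y u v, R x u → R y v → K x u = K y v → w x v + w y u = w x u + w y v)
    (π : Perm X) (hπ : ∀ x, π x = x ∨ R x (π x)) (hneg : ∑ x, w x (π x) < 0) :
    ∃ c : Perm X, (∀ x, c x = x ∨ R x (c x)) ∧ ∑ x, w x (c x) < 0 ∧
      ∀ x y, c x ≠ x → c y ≠ y → K x (c x) = K y (c y) → x = y := by
  classical
  have key : ∀ π : Perm X, (∀ x, π x = x ∨ R x (π x)) → ∑ x, w x (π x) < 0 →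
      ∃ c : Perm X, (c.IsCycle ∧ (∀ x, c x = x ∨ R x (c x)) ∧ ∑ x, w x (c x) < 0) ∧
        ∀ x, c x = x ∨ c x = π x := by
    intro π hπ hneg
    obtain ⟨c, hc, hcπ, hcn⟩ := exists_isCycle_sum_neg w hw π hneg
    refine ⟨c, ⟨hc, fun x => ?_, hcn⟩, hcπ⟩
    rcases hcπ x with h | h
    · exact Or.inl h
    · rw [h]; exact hπ x
  obtain ⟨c₀, hc₀, -⟩ := key π hπ hneg
  obtain ⟨c, ⟨hc, hcR, hcn⟩, hmin⟩ := exists_minimalFor_of_wellFoundedLT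
    (fun c : Perm X => c.IsCycle ∧ (∀ x, c x = x ∨ R x (c x)) ∧ ∑ x, w x (c x) < 0)
    (fun c => c.support.card) ⟨c₀, hc₀⟩
  refine ⟨c, hcR, hcn, fun x y hx hy hK => ?_⟩
  by_contra hxy
  have hRx := (hcR x).resolve_left hx
  have hRy := (hcR y).resolve_left hy
  set c' : Perm X := c * swap x y with hc'
  have hx' : c' x = c y := by simp [hc']
  have hy' : c' y = c x := by simp [hc']
  have hz' : ∀ z, z ≠ x → z ≠ y → c' z = c z := fun z h₁ h₂ => by
    simp [hc', swap_apply_of_ne_of_ne h₁ h₂]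
  have hR' : ∀ z, c' z = z ∨ R z (c' z) := fun z => by
    by_cases h₁ : z = x
    · subst h₁; rw [hx']; exact Or.inr (hR _ _ _ _ hRx hRy hK)
    by_cases h₂ : z = y
    · subst h₂; rw [hy']; exact Or.inr (hR _ _ _ _ hRy hRx hK.symm)
    rw [hz' z h₁ h₂]; exact hcR z
  have hsum : ∑ z, w z (c' z) = ∑ z, w z (c z) := by
    rw [← sub_eq_zero, ← Finset.sum_sub_distrib,
      ← Finset.sum_subset (Finset.subset_univ {x, y}), Finset.sum_pair hxy, hx', hy']
    · linarith [hex _ _ _ _ hRx hRy hK]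
    · intro z _ hz
      simp only [Finset.mem_insert, Finset.mem_singleton, not_or] at hz
      rw [hz' z hz.1 hz.2, sub_self]
  have hsupp : c'.support ⊆ c.support := fun z hz => by
    rw [Perm.mem_support] at hz ⊢
    by_cases h₁ : z = x
    · rwa [h₁]
    by_cases h₂ : z = y
    · rwa [h₂]
    rwa [hz' z h₁ h₂] at hz
  obtain ⟨d, hd, hdc⟩ := key c' hR' (hsum ▸ hcn)
  have hds : d.support ⊆ c'.support := fun z hz => by
    rw [Perm.mem_support] at hz ⊢
    rwa [← (hdc z).resolve_left hz]
  have hcard : c.support.card ≤ d.support.card := by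
    rcases le_total c.support.card d.support.card with h | h
    · exact h
    · exact hmin hd h
  have hdeq : d.support = c'.support :=
    Finset.eq_of_subset_of_card_le hds ((Finset.card_le_card hsupp).trans hcard)
  have hd' : d = c' := by
    ext z
    by_cases hz : d z = z
    · have : z ∉ c'.support := by rw [← hdeq, Perm.mem_support, not_not]; exact hz
      rw [hz, Perm.notMem_support.1 this]
    · exact (hdc z).resolve_left hz
  have hceq : c'.support = c.support :=
    Finset.eq_of_subset_of_card_le hsupp (hd' ▸ hcard)
  have hsign : Perm.sign c' = - Perm.sign c := by
    rw [hc', Perm.sign_mul, Perm.sign_swap hxy, mul_neg, mul_one]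
  have hc'c : c'.IsCycle := hd' ▸ hd.1
  rw [hc'c.sign, hc.sign, hceq] at hsign
  exact units_ne_neg_self _ hsign

end PermCycles

section Votes

variable {I β : Type*} [Fintype I] [DecidableEq β]

theorem lsgn_of_ne {r r' : ℕ} (h : r ≠ r') (j j' : ℕ) : lsgn r j r' j' = vsgn r r' := by
  simp [lsgn, vsgn, h, h.symm]

theorem lsgn_self (r j : ℕ) : lsgn r j r j = 0 := by simp [lsgn]

/-- The clone votes, indexed by the clones of a vertex, add up to the vote along `σ`. -/
theorem sum_lsgn_eq_sum_vsgn {r : β → ℕ} (hr : Function.Injective r) {S T : Finset β}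
    (hST : Disjoint S T) (σ : {x // x ∈ S} ≃ {x // x ∈ T}) {p q : I → β} (pj qj : I → ℕ)
    (hp : Function.Injective p) (hS : ∀ u ∈ S, ∃ i, p i = u)
    (hσ : ∀ i (h : p i ∈ S), (σ ⟨p i, h⟩).1 = q i)
    (hfix : ∀ i, p i ∉ S → p i = q i ∧ pj i = qj i) :
    ∑ i, lsgn (r (p i)) (pj i) (r (q i)) (qj i)
      = ∑ x : {x // x ∈ S}, vsgn (r x.1) (r ((σ x).1)) := by
  let F : β → ℤ := fun b => if h : b ∈ S then vsgn (r b) (r (σ ⟨b, h⟩).1) else 0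
  have h₁ : ∀ i, lsgn (r (p i)) (pj i) (r (q i)) (qj i) = F (p i) := by
    intro i
    by_cases h : p i ∈ S
    · simp only [F, h, dif_pos, hσ i h]
      refine lsgn_of_ne (fun he => ?_) _ _
      have hq : q i ∈ T := hσ i h ▸ (σ ⟨p i, h⟩).2
      exact Finset.disjoint_left.1 hST h (hr he ▸ hq)
    · obtain ⟨hpq, hj⟩ := hfix i h
      simp only [F, h, dif_neg, not_false_eq_true]
      rw [hpq, hj, lsgn_self]
  have h₂ : ∀ x : {x // x ∈ S}, vsgn (r x.1) (r ((σ x).1)) = F x.1 := fun x => by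
    simp [F]
  rw [Finset.sum_congr rfl fun i _ => h₁ i, Finset.sum_congr rfl fun x _ => h₂ x,
    Finset.sum_coe_sort S F, ← Finset.sum_image (s := Finset.univ) (g := p) (f := F) hp.injOn]
  refine (Finset.sum_subset (fun u hu => ?_) fun u _ hu => ?_).symm
  · obtain ⟨i, rfl⟩ := hS u hu
    exact Finset.mem_image_of_mem _ (Finset.mem_univ i)
  · simp [F, hu]

omit [Fintype I] [DecidableEq β] in
/-- Two injective families that are simultaneously in `S` and `T` induce a bijection. -/
theorem exists_equiv_apply_eq {S T : Finset β} {p q : I → β} (hp : Function.Injective p)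
    (hq : Function.Injective q) (hS : ∀ u ∈ S, ∃ i, p i = u) (hT : ∀ u ∈ T, ∃ i, q i = u)
    (hpq : ∀ i, p i ∈ S ↔ q i ∈ T) :
    ∃ σ : {x // x ∈ S} ≃ {x // x ∈ T}, ∀ i (h : p i ∈ S), (σ ⟨p i, h⟩).1 = q i := by
  choose g hg using fun u : {x // x ∈ S} => hS u.1 u.2
  let f : {x // x ∈ S} → {x // x ∈ T} :=
    fun u => ⟨q (g u), (hpq _).1 (by rw [hg u]; exact u.2)⟩
  have hf : Function.Bijective f := by
    refine ⟨fun u v h => ?_, fun t => ?_⟩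
    · have : g u = g v := hq (Subtype.ext_iff.1 h)
      exact Subtype.ext (by rw [← hg u, ← hg v, this])
    · obtain ⟨i, hi⟩ := hT t.1 t.2
      have hiS : p i ∈ S := (hpq i).2 (hi ▸ t.2)
      refine ⟨⟨p i, hiS⟩, Subtype.ext ?_⟩
      have : g ⟨p i, hiS⟩ = i := hp (hg ⟨p i, hiS⟩)
      simp [f, this, hi]
  refine ⟨Equiv.ofBijective f hf, fun i h => ?_⟩
  have : g ⟨p i, h⟩ = i := hp (hg ⟨p i, h⟩)
  simp [f, this]

end Votes

section Matchings

variable {A B : Type*} [DecidableEq A] [DecidableEq B] {capA : A → ℕ} {capB : B → ℕ}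

theorem mem_jobsOf {M : Finset (A × B)} {a : A} {b : B} : b ∈ jobsOf M a ↔ (a, b) ∈ M := by
  simp [jobsOf]

theorem mem_agentsOf {M : Finset (A × B)} {a : A} {b : B} :
    a ∈ agentsOf M b ↔ (a, b) ∈ M := by
  simp [agentsOf]

/-- The matching with the two sides of the instance exchanged. -/
def flipEdges (M : Finset (A × B)) : Finset (B × A) := M.map (Equiv.prodComm A B).toEmbedding

omit [DecidableEq A] [DecidableEq B] in
theorem mem_flipEdges {M : Finset (A × B)} {a : A} {b : B} :
    (b, a) ∈ flipEdges M ↔ (a, b) ∈ M := by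
  simp [flipEdges]

theorem jobsOf_flipEdges (M : Finset (A × B)) (b : B) :
    jobsOf (flipEdges M) b = agentsOf M b := by
  ext a; rw [mem_jobsOf, mem_flipEdges, mem_agentsOf]

omit [DecidableEq A] in
theorem card_filter_flipEdges (M : Finset (A × B)) (b : B) :
    ((flipEdges M).filter (fun e => e.1 = b)).card = (M.filter (fun e => e.2 = b)).card := by
  rw [flipEdges, Finset.filter_map, Finset.card_map]
  rfl

/-- The edges of `P` project bijectively onto the edge set `N`. -/
structure ProjectsTo (P : Clones capA ≃ Clones capB) (N : Finset (A × B)) : Prop where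
  inj : Function.Injective fun x : Clones capA => (x.1, (P x).1)
  mem : ∀ e, e ∈ N ↔ ∃ x : Clones capA, (x.1, (P x).1) = e

omit [DecidableEq A] [DecidableEq B] in
theorem ProjectsTo.flip {P : Clones capA ≃ Clones capB} {N : Finset (A × B)}
    (h : ProjectsTo P N) : ProjectsTo P.symm (flipEdges N) where
  inj x y hxy := by
    simp only [Prod.mk.injEq] at hxy
    apply P.symm.injective
    apply h.inj
    simp [hxy.1, hxy.2]
  mem := by
    rintro ⟨b, a⟩
    rw [mem_flipEdges, h.mem]
    constructor
    · rintro ⟨x, hx⟩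
      simp only [Prod.mk.injEq] at hx
      exact ⟨P x, by simp [hx.1, hx.2]⟩
    · rintro ⟨y, hy⟩
      simp only [Prod.mk.injEq] at hy
      exact ⟨P.symm y, by simp [hy.1, hy.2]⟩

omit [DecidableEq A] [DecidableEq B] in
theorem ProjectsTo.injective_fiber {P : Clones capA ≃ Clones capB} {N : Finset (A × B)}
    (h : ProjectsTo P N) (a : A) : Function.Injective fun i : Fin (capA a) => (P ⟨a, i⟩).1 := by
  intro i j hij
  have := @h.inj ⟨a, i⟩ ⟨a, j⟩ (Prod.ext rfl hij)
  simpa using this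

theorem ProjectsTo.mem_jobsOf_iff {P : Clones capA ≃ Clones capB} {N : Finset (A × B)}
    (h : ProjectsTo P N) {a : A} {b : B} :
    b ∈ jobsOf N a ↔ ∃ i : Fin (capA a), (P ⟨a, i⟩).1 = b := by
  rw [mem_jobsOf, h.mem]
  constructor
  · rintro ⟨⟨a', i⟩, hx⟩
    simp only [Prod.mk.injEq] at hx
    obtain ⟨rfl, hb⟩ := hx
    exact ⟨i, hb⟩
  · rintro ⟨i, rfl⟩
    exact ⟨⟨a, i⟩, rfl⟩

omit [DecidableEq B] in
theorem ProjectsTo.card_fiber {P : Clones capA ≃ Clones capB} {N : Finset (A × B)}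
    (h : ProjectsTo P N) (a : A) : (N.filter (fun e => e.1 = a)).card = capA a := by
  classical
  have : N.filter (fun e => e.1 = a)
      = Finset.univ.image fun i : Fin (capA a) => (a, (P ⟨a, i⟩).1) := by
    ext ⟨a', b⟩
    simp only [Finset.mem_filter, Finset.mem_image, Finset.mem_univ, true_and, Prod.mk.injEq]
    constructor
    · rintro ⟨hN, rfl⟩
      obtain ⟨i, hi⟩ := h.mem_jobsOf_iff.1 (mem_jobsOf.2 hN)
      exact ⟨i, rfl, hi⟩
    · rintro ⟨i, rfl, rfl⟩
      exact ⟨mem_jobsOf.1 (h.mem_jobsOf_iff.2 ⟨i, rfl⟩), rfl⟩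
  rw [this, Finset.card_image_of_injective, Finset.card_univ, Fintype.card_fin]
  intro i j hij
  exact h.injective_fiber a (Prod.ext_iff.1 hij).2

theorem ProjectsTo.isPerfect {P : Clones capA ≃ Clones capB} {E N : Finset (A × B)}
    (h : ProjectsTo P N) (hE : N ⊆ E) : IsPerfect E N capA capB :=
  ⟨hE, h.card_fiber, fun b => by rw [← card_filter_flipEdges]; exact h.flip.card_fiber b⟩

/-- If `Q` uses an `M`-edge only where it agrees with the realization `P` of `M`, then the
total vote of the clones of `a` is a possible vote of `a`. -/
theorem ProjectsTo.sum_lsgn_mem_voteSet {P Q : Clones capA ≃ Clones capB}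
    {M N : Finset (A × B)} (hP : ProjectsTo P M) (hQ : ProjectsTo Q N)
    (hPQ : ∀ x, P x = Q x ∨ (x.1, (Q x).1) ∉ M) (a : A) {r : B → ℕ}
    (hr : Function.Injective r) :
    ∑ i : Fin (capA a), lsgn (r (P ⟨a, i⟩).1) (P ⟨a, i⟩).2 (r (Q ⟨a, i⟩).1) (Q ⟨a, i⟩).2
      ∈ voteSet r (jobsOf M a \ jobsOf N a) (jobsOf N a \ jobsOf M a) := by
  set S := jobsOf M a \ jobsOf N a with hSdef
  set T := jobsOf N a \ jobsOf M a with hTdef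
  have hp := hP.injective_fiber a
  have hq := hQ.injective_fiber a
  have hPM : ∀ i, (P ⟨a, i⟩).1 ∈ jobsOf M a := fun i => hP.mem_jobsOf_iff.2 ⟨i, rfl⟩
  have hQN : ∀ i, (Q ⟨a, i⟩).1 ∈ jobsOf N a := fun i => hQ.mem_jobsOf_iff.2 ⟨i, rfl⟩
  have hS : ∀ i, (P ⟨a, i⟩).1 ∈ S ↔ P ⟨a, i⟩ ≠ Q ⟨a, i⟩ := by
    intro i
    rw [hSdef, Finset.mem_sdiff, and_iff_right (hPM i)]
    refine ⟨fun h he => h (he ▸ hQN i), fun h hN => ?_⟩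
    obtain ⟨j, hj⟩ := hQ.mem_jobsOf_iff.1 hN
    have hjM : (a, (Q ⟨a, j⟩).1) ∈ M := mem_jobsOf.1 (hj ▸ hPM i)
    have hje := (hPQ ⟨a, j⟩).resolve_right (not_not.2 hjM)
    have : j = i := hp (show (P ⟨a, j⟩).1 = (P ⟨a, i⟩).1 by rw [hje, hj])
    exact h (this ▸ hje)
  have hT : ∀ i, (Q ⟨a, i⟩).1 ∈ T ↔ P ⟨a, i⟩ ≠ Q ⟨a, i⟩ := by
    intro i
    rw [hTdef, Finset.mem_sdiff, and_iff_right (hQN i), mem_jobsOf]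
    exact ⟨fun h he => h (mem_jobsOf.1 (he ▸ hPM i)), fun h => (hPQ ⟨a, i⟩).resolve_left h⟩
  have hS' : ∀ u ∈ S, ∃ i, (P ⟨a, i⟩).1 = u := fun u hu =>
    hP.mem_jobsOf_iff.1 (Finset.mem_sdiff.1 hu).1
  obtain ⟨σ, hσ⟩ := exists_equiv_apply_eq (S := S) (T := T) hp hq hS'
    (fun u hu => hQ.mem_jobsOf_iff.1 (Finset.mem_sdiff.1 hu).1)
    (fun i => (hS i).trans (hT i).symm)
  refine ⟨σ, sum_lsgn_eq_sum_vsgn hr disjoint_sdiff_sdiff σ _ _ hp hS' hσ fun i hi => ?_⟩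
  have he : P ⟨a, i⟩ = Q ⟨a, i⟩ := not_not.1 (mt (hS i).2 hi)
  exact ⟨congrArg Sigma.fst he, by rw [he]⟩

variable [Fintype A]

omit [DecidableEq B] [Fintype A] in
/-- If every vertex `a` has exactly `capA a` edges in `N`, the clones parametrize `N`. -/
theorem exists_equiv_fst_eq {N : Finset (A × B)}
    (hN : ∀ a, (N.filter (fun e => e.1 = a)).card = capA a) :
    ∃ e : Clones capA ≃ {e // e ∈ N}, ∀ x, (e x).1.1 = x.1 := by
  have hcard : ∀ a, Fintype.card {e : {e // e ∈ N} // e.1.1 = a} = capA a := by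
    intro a
    rw [← hN a, ← Fintype.card_coe]
    refine Fintype.card_congr ((Equiv.subtypeSubtypeEquivSubtypeInter
      (fun e : A × B => e ∈ N) (fun e => e.1 = a)).trans
        (Equiv.subtypeEquivRight fun e => ?_))
    simp
  let φ : ∀ a, Fin (capA a) ≃ {e : {e // e ∈ N} // e.1.1 = a} := fun a =>
    (Fintype.equivFinOfCardEq (hcard a)).symm
  refine ⟨(Equiv.sigmaCongrRight φ).trans (Equiv.sigmaFiberEquiv fun e : {e // e ∈ N} => e.1.1),
    fun x => ?_⟩
  exact (φ x.1 x.2).2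

/-- A family of bijections turning `M`-partners into `N`-partners parametrizes `N` by the
clones, compatibly with the realization `P` of `M`. -/
theorem ProjectsTo.exists_equiv_edges {P : Clones capA ≃ Clones capB} {M N : Finset (A × B)}
    (hP : ProjectsTo P M) (hN : ∀ a, (N.filter (fun e => e.1 = a)).card = capA a)
    (σ : ∀ a, {b // b ∈ jobsOf M a \ jobsOf N a} ≃ {b // b ∈ jobsOf N a \ jobsOf M a}) :
    ∃ e : Clones capA ≃ {e // e ∈ N}, (∀ x, (e x).1.1 = x.1) ∧
      (∀ (x : Clones capA) (h : (P x).1 ∈ jobsOf M x.1 \ jobsOf N x.1),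
        (e x).1.2 = (σ x.1 ⟨(P x).1, h⟩).1) ∧
      ∀ x, (P x).1 ∉ jobsOf M x.1 \ jobsOf N x.1 → (e x).1.2 = (P x).1 := by
  have hPM : ∀ x : Clones capA, (x.1, (P x).1) ∈ M := fun x => (hP.mem _).2 ⟨x, rfl⟩
  obtain ⟨s, hs₁, hs₂⟩ : ∃ s : Clones capA → B,
      (∀ (x : Clones capA) (h : (P x).1 ∈ jobsOf M x.1 \ jobsOf N x.1),
        s x = (σ x.1 ⟨(P x).1, h⟩).1) ∧
      ∀ x, (P x).1 ∉ jobsOf M x.1 \ jobsOf N x.1 → s x = (P x).1 := by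
    have : ∀ x : Clones capA, ∃ b : B, (∀ h : (P x).1 ∈ jobsOf M x.1 \ jobsOf N x.1,
        b = (σ x.1 ⟨(P x).1, h⟩).1) ∧
        ((P x).1 ∉ jobsOf M x.1 \ jobsOf N x.1 → b = (P x).1) := by
      intro x
      by_cases h : (P x).1 ∈ jobsOf M x.1 \ jobsOf N x.1
      · exact ⟨(σ x.1 ⟨(P x).1, h⟩).1, fun _ => rfl, fun h' => absurd h h'⟩
      · exact ⟨_, fun h' => absurd h' h, fun _ => rfl⟩
    choose s hs using this
    exact ⟨s, fun x => (hs x).1, fun x => (hs x).2⟩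
  have hsT : ∀ x, (P x).1 ∈ jobsOf M x.1 \ jobsOf N x.1 →
      s x ∈ jobsOf N x.1 \ jobsOf M x.1 := fun x h => by
    rw [hs₁ x h]; exact (σ x.1 ⟨_, h⟩).2
  have hsM : ∀ x, (P x).1 ∉ jobsOf M x.1 \ jobsOf N x.1 → s x ∈ jobsOf M x.1 :=
    fun x h => by rw [hs₂ x h]; exact mem_jobsOf.2 (hPM x)
  have hsN : ∀ x, (x.1, s x) ∈ N := by
    intro x
    by_cases h : (P x).1 ∈ jobsOf M x.1 \ jobsOf N x.1
    · exact mem_jobsOf.1 (Finset.mem_sdiff.1 (hsT x h)).1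
    · rw [hs₂ x h]
      by_contra hN'
      exact h (Finset.mem_sdiff.2 ⟨mem_jobsOf.2 (hPM x), fun h' => hN' (mem_jobsOf.1 h')⟩)
  have hsinj : ∀ (a : A) (i j : Fin (capA a)), s ⟨a, i⟩ = s ⟨a, j⟩ → i = j := by
    intro a i j h
    refine hP.injective_fiber a (?_ : (P ⟨a, i⟩).1 = (P ⟨a, j⟩).1)
    by_cases hi : (P ⟨a, i⟩).1 ∈ jobsOf M a \ jobsOf N a <;>
      by_cases hj : (P ⟨a, j⟩).1 ∈ jobsOf M a \ jobsOf N a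
    · rw [hs₁ ⟨a, i⟩ hi, hs₁ ⟨a, j⟩ hj] at h
      exact congrArg Subtype.val ((σ a).injective (Subtype.ext h))
    · have h' := (Finset.mem_sdiff.1 (hsT ⟨a, i⟩ hi)).2
      rw [h] at h'
      exact absurd (hsM ⟨a, j⟩ hj) h'
    · have h' := (Finset.mem_sdiff.1 (hsT ⟨a, j⟩ hj)).2
      rw [← h] at h'
      exact absurd (hsM ⟨a, i⟩ hi) h'
    · rw [hs₂ ⟨a, i⟩ hi, hs₂ ⟨a, j⟩ hj] at h
      exact h
  let f : Clones capA → {e // e ∈ N} := fun x => ⟨(x.1, s x), hsN x⟩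
  have hf : Function.Injective f := by
    rintro ⟨a, i⟩ ⟨a', j⟩ hxy
    obtain ⟨h₁, h₂⟩ := Prod.mk.inj (congrArg Subtype.val hxy)
    subst h₁
    rw [hsinj a i j h₂]
  obtain ⟨e₀, -⟩ := exists_equiv_fst_eq hN
  have hbij : Function.Bijective f :=
    (Fintype.bijective_iff_injective_and_card f).2 ⟨hf, Fintype.card_congr e₀⟩
  exact ⟨Equiv.ofBijective f hbij, fun _ => rfl, hs₁, hs₂⟩

omit [DecidableEq B] in
theorem Realizes.projectsTo {P : Clones capA ≃ Clones capB} {M : Finset (A × B)}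
    (h : Realizes P M) (hM : ∀ a, (M.filter (fun e => e.1 = a)).card = capA a) :
    ProjectsTo P M := by
  have hinj : Function.Injective fun x : Clones capA => (x.1, (P x).1) := by
    intro x y hxy
    by_contra hne
    exact h.2 x y hne (Prod.ext_iff.1 hxy).1 (Prod.ext_iff.1 hxy).2
  refine ⟨hinj, fun e => ⟨fun he => ?_, ?_⟩⟩
  · obtain ⟨e₀, -⟩ := exists_equiv_fst_eq hM
    let f : Clones capA → {e // e ∈ M} := fun x => ⟨(x.1, (P x).1), h.1 x⟩
    have hf : Function.Bijective f := (Fintype.bijective_iff_injective_and_card f).2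
      ⟨fun x y hxy => hinj (Subtype.ext_iff.1 hxy), Fintype.card_congr e₀⟩
    obtain ⟨x, hx⟩ := hf.2 ⟨e, he⟩
    exact ⟨x, Subtype.ext_iff.1 hx⟩
  · rintro ⟨x, rfl⟩
    exact h.1 x

omit [DecidableEq A] [DecidableEq B] [Fintype A] in
theorem ProjectsTo.realizes {P : Clones capA ≃ Clones capB} {M : Finset (A × B)}
    (h : ProjectsTo P M) : Realizes P M :=
  ⟨fun x => (h.mem _).2 ⟨x, rfl⟩, fun _ _ hxy h₁ h₂ => hxy (h.inj (Prod.ext h₁ h₂))⟩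

/-- The edge set `flipEdges N` is in bijection with `N`. -/
def flipEquiv (N : Finset (A × B)) : {e // e ∈ flipEdges N} ≃ {e // e ∈ N} :=
  Equiv.subtypeEquiv (Equiv.prodComm B A) (by rintro ⟨b, a⟩; exact mem_flipEdges)

omit [DecidableEq A] [DecidableEq B] [Fintype A] in
/-- Compatible parametrizations of `N` by the clones of both sides yield a one-to-one matching
projecting to `N`. -/
theorem projectsTo_trans_symm {N : Finset (A × B)} (eA : Clones capA ≃ {e // e ∈ N})
    (eB : Clones capB ≃ {e // e ∈ flipEdges N}) (hA : ∀ x, (eA x).1.1 = x.1)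
    (hB : ∀ y, (eB y).1.1 = y.1) :
    ProjectsTo (eA.trans (eB.trans (flipEquiv N)).symm) N ∧
      (∀ x, ((eA.trans (eB.trans (flipEquiv N)).symm) x).1 = (eA x).1.2) ∧
      ∀ y, ((eA.trans (eB.trans (flipEquiv N)).symm).symm y).1 = (eB y).1.2 := by
  set P := eA.trans (eB.trans (flipEquiv N)).symm with hPdef
  have hP : ∀ x, (eB.trans (flipEquiv N)) (P x) = eA x := fun x => by
    simp only [hPdef, Equiv.trans_apply, Equiv.apply_symm_apply]
  have h₁ : ∀ x, (P x).1 = (eA x).1.2 := fun x => by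
    rw [← hP x, ← hB]; rfl
  have h₂ : ∀ y, (P.symm y).1 = (eB y).1.2 := fun y => by
    rw [← hA, ← hP, Equiv.apply_symm_apply]; rfl
  have he : ∀ x : Clones capA, (x.1, (P x).1) = (eA x).1 := fun x => by
    rw [h₁, ← hA x]
  refine ⟨⟨fun x y hxy => ?_, fun e => ⟨fun h => ?_, ?_⟩⟩, h₁, h₂⟩
  · simp only [he] at hxy
    exact eA.injective (Subtype.ext hxy)
  · exact ⟨eA.symm ⟨e, h⟩, by rw [he, Equiv.apply_symm_apply]⟩
  · rintro ⟨x, rfl⟩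
    rw [he]; exact (eA x).2

variable [Fintype B]

omit [Fintype A] [Fintype B] in
/-- Every perfect matching has a one-to-one realization. -/
theorem IsPerfect.exists_projectsTo {E M : Finset (A × B)} (hM : IsPerfect E M capA capB) :
    ∃ P : Clones capA ≃ Clones capB, ProjectsTo P M := by
  obtain ⟨eA, hA⟩ := exists_equiv_fst_eq hM.2.1
  obtain ⟨eB, hB⟩ := exists_equiv_fst_eq (N := flipEdges M) (capA := capB)
    fun b => by rw [card_filter_flipEdges]; exact hM.2.2 b
  exact ⟨_, (projectsTo_trans_symm eA eB hA hB).1⟩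

/-- A realization that is not beaten in the cloned instance makes `M` popular. -/
theorem ProjectsTo.popularPerfect {rA : A → B → ℕ} {rB : B → A → ℕ}
    (hrA : ∀ a, Function.Injective (rA a)) (hrB : ∀ b, Function.Injective (rB b))
    {E M : Finset (A × B)} (hM : IsPerfect E M capA capB) {P : Clones capA ≃ Clones capB}
    (hP : ProjectsTo P M)
    (hpop : ∀ Q : Clones capA ≃ Clones capB, (∀ x, inEM E M P x (Q x)) →
      0 ≤ Delta' rA rB P Q) :
    PopularPerfect E capA capB rA rB M := by
  refine ⟨hM, fun N hN za zb hza hzb => ?_⟩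
  choose σ hσ using hza
  simp only [← jobsOf_flipEdges] at hzb
  choose τ hτ using hzb
  obtain ⟨eA, hA, hA₁, hA₂⟩ := hP.exists_equiv_edges hN.2.1 σ
  obtain ⟨eB, hB, hB₁, hB₂⟩ := hP.flip.exists_equiv_edges
    (fun b => by rw [card_filter_flipEdges]; exact hN.2.2 b) τ
  obtain ⟨hQ, hQ₁, hQ₂⟩ := projectsTo_trans_symm eA eB hA hB
  set Q := eA.trans (eB.trans (flipEquiv N)).symm with hQdef
  have hPM : ∀ x : Clones capA, (x.1, (P x).1) ∈ M := fun x => (hP.mem _).2 ⟨x, rfl⟩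
  have hfix : ∀ x, (P x).1 ∉ jobsOf M x.1 \ jobsOf N x.1 → Q x = P x := by
    intro x hx
    have hxN : (x.1, (P x).1) ∈ N := by
      simpa [mem_jobsOf, hPM x] using hx
    have hy : (P.symm (P x)).1 ∉
        jobsOf (flipEdges M) (P x).1 \ jobsOf (flipEdges N) (P x).1 := by
      simp [mem_jobsOf, mem_flipEdges, hxN]
    have h₂ := hB₂ (P x) hy
    rw [← hQ₂, Equiv.symm_apply_apply] at h₂
    have h₁ := hA₂ x hx
    rw [← Equiv.symm_apply_eq Q |>.1 (?_ : Q.symm (P x) = x)]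
    refine hQ.inj (Prod.ext h₂ ?_)
    simp only [Equiv.apply_symm_apply]
    rw [hQ₁, h₁]
  have hfix' : ∀ y, (P.symm y).1 ∉
      jobsOf (flipEdges M) y.1 \ jobsOf (flipEdges N) y.1 → Q.symm y = P.symm y := by
    intro y hy
    have hx : (P (P.symm y)).1 ∉ jobsOf M (P.symm y).1 \ jobsOf N (P.symm y).1 := by
      simpa [mem_jobsOf, mem_flipEdges, hPM] using hy
    rw [Equiv.symm_apply_eq, hfix _ hx, Equiv.apply_symm_apply]
  have hin : ∀ x, inEM E M P x (Q x) := by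
    intro x
    by_cases hx : (P x).1 ∈ jobsOf M x.1 \ jobsOf N x.1
    · right
      have hT := (σ x.1 ⟨_, hx⟩).2
      rw [← hA₁ x hx, ← hQ₁, Finset.mem_sdiff, mem_jobsOf, mem_jobsOf] at hT
      exact ⟨hN.1 hT.1, hT.2⟩
    · exact Or.inl (hfix x hx).symm
  have hDelta : Delta' rA rB P Q = ∑ a, za a + ∑ b, zb b := by
    unfold Delta'
    rw [Fintype.sum_sigma, Fintype.sum_sigma]
    congr 1
    · refine Finset.sum_congr rfl fun a _ => ?_
      rw [hσ a]
      refine sum_lsgn_eq_sum_vsgn (p := fun i => (P ⟨a, i⟩).1) (q := fun i => (Q ⟨a, i⟩).1)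
        (hrA a) disjoint_sdiff_sdiff (σ a) _ _
        (hP.injective_fiber a) (fun u hu => hP.mem_jobsOf_iff.1 (Finset.mem_sdiff.1 hu).1)
        (fun i h => ?_) fun i h => ?_
      · rw [hQ₁, hA₁ ⟨a, i⟩ h]
      · rw [hfix ⟨a, i⟩ h]; exact ⟨rfl, rfl⟩
    · refine Finset.sum_congr rfl fun b _ => ?_
      rw [hτ b]
      refine sum_lsgn_eq_sum_vsgn (p := fun i => (P.symm ⟨b, i⟩).1)
        (q := fun i => (Q.symm ⟨b, i⟩).1) (hrB b) disjoint_sdiff_sdiff (τ b) _ _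
        (hP.flip.injective_fiber b)
        (fun u hu => hP.flip.mem_jobsOf_iff.1 (Finset.mem_sdiff.1 hu).1)
        (fun i h => ?_) fun i h => ?_
      · rw [hQ₂, hB₁ ⟨b, i⟩ h]
      · rw [hfix' ⟨b, i⟩ h]; exact ⟨rfl, rfl⟩
  rw [← hDelta]
  exact hpop Q hin

/-- A one-to-one matching projecting injectively to the edges of `G` does not beat any
realization of a popular perfect matching. -/
theorem PopularPerfect.delta_nonneg {rA : A → B → ℕ} {rB : B → A → ℕ}
    (hrA : ∀ a, Function.Injective (rA a)) (hrB : ∀ b, Function.Injective (rB b))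
    {E M : Finset (A × B)} (hpop : PopularPerfect E capA capB rA rB M)
    {P Q : Clones capA ≃ Clones capB} (hP : ProjectsTo P M) (hin : ∀ x, inEM E M P x (Q x))
    (hinj : Function.Injective fun x : Clones capA => (x.1, (Q x).1)) :
    0 ≤ Delta' rA rB P Q := by
  let N : Finset (A × B) := Finset.univ.image fun x : Clones capA => (x.1, (Q x).1)
  have hQ : ProjectsTo Q N := ⟨hinj, fun e => by simp only [N, Finset.mem_image,
    Finset.mem_univ, true_and]⟩
  have hNE : N ⊆ E := by
    intro e he
    obtain ⟨x, rfl⟩ := (hQ.mem e).1 he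
    rcases hin x with h | h
    · rw [← h]; exact hpop.1.1 ((hP.mem _).2 ⟨x, rfl⟩)
    · exact h.1
  have hPQ : ∀ x, P x = Q x ∨ (x.1, (Q x).1) ∉ M := fun x => (hin x).imp_right And.right
  have hPQ' : ∀ y, P.symm y = Q.symm y ∨ (y.1, (Q.symm y).1) ∉ flipEdges M := by
    intro y
    rw [mem_flipEdges, Equiv.symm_apply_eq]
    have := hPQ (Q.symm y)
    rw [Equiv.apply_symm_apply] at this
    exact this.imp_left Eq.symm
  unfold Delta'
  rw [Fintype.sum_sigma, Fintype.sum_sigma]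
  refine hpop.2 N (hQ.isPerfect hNE) _ _
    (fun a => hP.sum_lsgn_mem_voteSet hQ hPQ a (hrA a)) fun b => ?_
  have := hP.flip.sum_lsgn_mem_voteSet hQ.flip hPQ' b (hrB b)
  rwa [jobsOf_flipEdges, jobsOf_flipEdges] at this

/-- Every realization of a popular perfect matching is popular in its cloned instance. -/
theorem PopularPerfect.delta_nonneg_of_inEM {rA : A → B → ℕ} {rB : B → A → ℕ}
    (hrA : ∀ a, Function.Injective (rA a)) (hrB : ∀ b, Function.Injective (rB b))
    {E M : Finset (A × B)} (hpop : PopularPerfect E capA capB rA rB M)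
    {P Q : Clones capA ≃ Clones capB} (hP : ProjectsTo P M)
    (hin : ∀ x, inEM E M P x (Q x)) : 0 ≤ Delta' rA rB P Q := by
  let w : Clones capA → Clones capA → ℤ := fun x z =>
    lsgn (rA x.1 (P x).1) (P x).2 (rA x.1 (P z).1) (P z).2 +
      lsgn (rB (P z).1 z.1) z.2 (rB (P z).1 x.1) x.2
  let R : Clones capA → Clones capA → Prop := fun x z =>
    (x.1, (P z).1) ∈ E ∧ (x.1, (P z).1) ∉ M
  have hPM : ∀ x : Clones capA, (x.1, (P x).1) ∈ M := fun x => (hP.mem _).2 ⟨x, rfl⟩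
  have hDelta : ∀ π : Equiv.Perm (Clones capA),
      Delta' rA rB P (π.trans P) = ∑ x, w x (π x) := by
    intro π
    unfold Delta'
    rw [← Equiv.sum_comp (π.trans P), ← Finset.sum_add_distrib]
    refine Finset.sum_congr rfl fun x _ => ?_
    rw [Equiv.symm_apply_apply, Equiv.trans_apply, Equiv.symm_apply_apply]
  have hw : ∀ x, w x x = 0 := fun x => by simp only [w, lsgn_self, add_zero]
  have hwR : ∀ x z, R x z → w x z = vsgn (rA x.1 (P x).1) (rA x.1 (P z).1) +
      vsgn (rB (P z).1 z.1) (rB (P z).1 x.1) := by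
    intro x z h
    have h₁ : rA x.1 (P x).1 ≠ rA x.1 (P z).1 := fun he => h.2 (hrA _ he ▸ hPM x)
    have h₂ : rB (P z).1 z.1 ≠ rB (P z).1 x.1 := fun he => h.2 (hrB _ he ▸ hPM z)
    simp only [w, lsgn_of_ne h₁, lsgn_of_ne h₂]
  have hR : ∀ x y u v, R x u → R y v → (x.1, (P u).1) = (y.1, (P v).1) → R x v := by
    intro x y u v hx hy hK
    rw [Prod.mk.injEq] at hK
    simp only [R] at hx ⊢
    rwa [← hK.2]
  by_contra! hneg
  obtain ⟨c, hc, hcn, hcK⟩ := exists_perm_injOn_key w hw R (fun x z => (x.1, (P z).1)) hR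
    (by
      intro x y u v hx hy hK
      have hxv := hR x y u v hx hy hK
      have hyu := hR y x v u hy hx hK.symm
      rw [hwR _ _ hx, hwR _ _ hy, hwR _ _ hxv, hwR _ _ hyu]
      rw [Prod.mk.injEq] at hK
      rw [hK.1, hK.2]
      ring)
    (Q.trans P.symm)
    (by
      intro x
      rcases hin x with h | h
      · left; simp [← h]
      · right; simpa [R] using h)
    (by
      have hQ : (Q.trans P.symm).trans P = Q := by ext x : 1; simp
      rw [← hDelta, hQ]
      exact hneg)
  refine absurd (hDelta c ▸ hcn) (not_lt.2 (hpop.delta_nonneg hrA hrB hP (fun x => ?_) ?_))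
  · exact (hc x).imp_left fun h => by simp [h]
  · intro x y hxy
    simp only [Equiv.trans_apply] at hxy
    by_cases hx : c x = x <;> by_cases hy : c y = y
    · rw [hx, hy] at hxy; exact hP.inj hxy
    · rw [hx] at hxy
      exact absurd (hxy ▸ hPM x) ((hc y).resolve_left hy).2
    · rw [hy] at hxy
      exact absurd (hxy ▸ hPM y) ((hc x).resolve_left hx).2
    · exact hcK x y hx hy hxy

end Matchings

/-- Corollary 1: a perfect matching `M` in a many-to-many instance is
a popular perfect matching iff some one-to-one realization `M'` of `M` is a popular
perfect matching in the one-to-one instance `G'_{M'}`, i.e. `Δ(M',N') ≥ 0` for every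
perfect matching `N'` of `G'_{M'}`. -/
theorem stmt8 {A B : Type*} [Fintype A] [Fintype B] [DecidableEq A] [DecidableEq B]
    (capA : A → ℕ) (capB : B → ℕ)
    (rA : A → B → ℕ) (rB : B → A → ℕ)
    (hrA : ∀ a, Function.Injective (rA a)) (hrB : ∀ b, Function.Injective (rB b))
    (E M : Finset (A × B)) (hM : IsPerfect E M capA capB) :
    PopularPerfect E capA capB rA rB M ↔
      ∃ M' : Clones capA ≃ Clones capB, Realizes M' M ∧
        ∀ N' : Clones capA ≃ Clones capB,
          (∀ x, inEM E M M' x (N' x)) → 0 ≤ Delta' rA rB M' N' := by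
  constructor
  · intro hpop
    obtain ⟨P, hP⟩ := hM.exists_projectsTo
    exact ⟨P, hP.realizes, fun Q hQ => hpop.delta_nonneg_of_inEM hrA hrB hP hQ⟩
  · rintro ⟨P, hP, hpop⟩
    exact (hP.projectsTo hM.2.1).popularPerfect hrA hrB hM hpop
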